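/- arXiv:2312.17665 — 6 statements merged into one kernel-verified Lean document; each statement's English description precedes it below -/
import Mathlib

section
/- For every α > 0 there exists a constant c ≥ 1, depending only on α, C0 and C1, such that for every (C0,C1)-elliptic symmetric matrix γ and all nonzero η, ξ ∈ ℝ^{nN} one has (1/c) · | |η|_γ^{α−1} η − |ξ|_γ^{α−1} ξ | ≤ (|η|_γ + |ξ|_γ)^{α−1} |η − ξ| ≤ c · | |η|_γ^{α−1} η − |ξ|_γ^{α−1} ξ |. -/
noncomputable section

open Real

/-- The `γ`-inner product on `ℝ^{nN}`. -/
def gInner {n N : ℕ} (γ : Matrix (Fin n) (Fin n) ℝ) (ξ η : Fin N → Fin n → ℝ) : ℝ :=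
  ∑ i, ∑ α, ∑ β, γ α β * ξ i α * η i β

/-- The `γ`-norm on `ℝ^{nN}`. -/
def gNorm {n N : ℕ} (γ : Matrix (Fin n) (Fin n) ℝ) (ξ : Fin N → Fin n → ℝ) : ℝ :=
  Real.sqrt (gInner γ ξ ξ)

/-- The Euclidean norm on `ℝ^{nN}`. -/
def eNorm {n N : ℕ} (ξ : Fin N → Fin n → ℝ) : ℝ :=
  Real.sqrt (∑ i, ∑ α, ξ i α ^ 2)

/-- A symmetric `(C0, C1)`-elliptic matrix. -/
def IsElliptic {n : ℕ} (C0 C1 : ℝ) (γ : Matrix (Fin n) (Fin n) ℝ) : Prop :=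
  (∀ α β, γ α β = γ β α) ∧
  ∀ ζ : Fin n → ℝ,
    C0 * ∑ α, ζ α ^ 2 ≤ (∑ α, ∑ β, γ α β * ζ α * ζ β) ∧
    (∑ α, ∑ β, γ α β * ζ α * ζ β) ≤ C1 * ∑ α, ζ α ^ 2

/-- `h(t) = (t-1)_+^{p-1} / t` (with the convention `h(0) = 0`). -/
def hfun (p t : ℝ) : ℝ := (max (t - 1) 0) ^ (p - 1) / t

/-- `g(t) = (t-1)_+^p / t`. -/
def gfun (p t : ℝ) : ℝ := (max (t - 1) 0) ^ p / t

/-- The derivative of `h` on `(1,∞)`, extended by `0` elsewhere. -/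
def hderiv (p s : ℝ) : ℝ :=
  if 1 < s then (s - 1) ^ (p - 2) * ((p - 2) * s + 1) / s ^ 2 else 0

/-- The derivative of `g` on `(1,∞)`, extended by `0` elsewhere. -/
def gderiv (p s : ℝ) : ℝ :=
  if 1 < s then (s - 1) ^ (p - 1) * ((p - 1) * s + 1) / s ^ 2 else 0

/-- `λ(t) = min{h(t), (p-1)(t-1)^{p-2}}` for `t > 1`, and `0` for `t ≤ 1`. -/
def lamFun (p t : ℝ) : ℝ :=
  if 1 < t then min (hfun p t) ((p - 1) * (t - 1) ^ (p - 2)) else 0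

/-- `Λ(t) = max{h(t), (p-1)(t-1)^{p-2}}` for `t > 1`, and `0` for `t ≤ 1`. -/
def LamFun (p t : ℝ) : ℝ :=
  if 1 < t then max (hfun p t) ((p - 1) * (t - 1) ^ (p - 2)) else 0

/-- The vector field `A_ε(γ, ξ) = h_ε(|ξ|_γ) ξ` (equal to `0` at `ξ = 0`). -/
def Avf {n N : ℕ} (p ε : ℝ) (γ : Matrix (Fin n) (Fin n) ℝ) (ξ : Fin N → Fin n → ℝ) :
    Fin N → Fin n → ℝ :=
  fun i α => (hfun p (gNorm γ ξ) + ε) * ξ i α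

/-- The map `G_δ(γ, ξ) = ((|ξ|_γ - 1 - δ)_+ / |ξ|_γ) ξ` (equal to `0` at `ξ = 0`). -/
def Gmap {n N : ℕ} (δ : ℝ) (γ : Matrix (Fin n) (Fin n) ℝ) (ξ : Fin N → Fin n → ℝ) :
    Fin N → Fin n → ℝ :=
  fun i α => (max (gNorm γ ξ - 1 - δ) 0) / gNorm γ ξ * ξ i α

/-- The bilinear form `𝒜_ε(γ, ξ)` on third-order tensors in `ℝ^{n²N}`. -/
def Aform {n N : ℕ} (p ε : ℝ) (γ : Matrix (Fin n) (Fin n) ℝ) (ξ : Fin N → Fin n → ℝ)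
    (η ζ : Fin N → Fin n → Fin n → ℝ) : ℝ :=
  ∑ i, ∑ j, ∑ α, ∑ β, ∑ ν, ∑ σ,
    ((hfun p (gNorm γ ξ) + ε) * γ α β * (if i = j then (1 : ℝ) else 0) +
        hderiv p (gNorm γ ξ) / gNorm γ ξ *
          (∑ d, γ α d * ξ i d) * (∑ k, γ β k * ξ j k)) *
      γ ν σ * η i α ν * ζ j β σ

/-- The bilinear form `ℬ_ε(γ, ξ)` on `ℝ^{nN}`. -/
def Bform {n N : ℕ} (p ε : ℝ) (γ : Matrix (Fin n) (Fin n) ℝ) (ξ : Fin N → Fin n → ℝ)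
    (η ζ : Fin N → Fin n → ℝ) : ℝ :=
  ∑ i, ∑ j, ∑ α, ∑ β,
    ((hfun p (gNorm γ ξ) + ε) * γ α β * (if i = j then (1 : ℝ) else 0) +
        hderiv p (gNorm γ ξ) / gNorm γ ξ *
          (∑ d, γ α d * ξ i d) * (∑ k, γ β k * ξ j k)) *
      η i α * ζ j β

/-- The bilinear form `𝒞_ε(γ, ξ)` on `ℝ^n`. -/
def Cform {n N : ℕ} (p ε : ℝ) (γ : Matrix (Fin n) (Fin n) ℝ) (ξ : Fin N → Fin n → ℝ)
    (ζ ζ' : Fin n → ℝ) : ℝ :=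
  ∑ α, ∑ β,
    ((hfun p (gNorm γ ξ) + ε) * γ α β +
        hderiv p (gNorm γ ξ) / gNorm γ ξ *
          (∑ i, (∑ d, γ α d * ξ i d) * (∑ k, γ β k * ξ i k))) *
      ζ α * ζ' β

/-- The squared `γ`-norm of a third-order tensor in `ℝ^{n²N}`. -/
def tNormSq {n N : ℕ} (γ : Matrix (Fin n) (Fin n) ℝ) (η : Fin N → Fin n → Fin n → ℝ) : ℝ :=
  ∑ i, ∑ α, ∑ β, ∑ ν, ∑ σ, γ α β * γ ν σ * η i α ν * η i β σ

lemma rpow_bounds_of_mem_Icc {x : ℝ} (b : ℝ) (h1 : 1 / 2 ≤ x) (h2 : x ≤ 2) :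
    ((2 : ℝ) ^ |b|)⁻¹ ≤ x ^ b ∧ x ^ b ≤ (2 : ℝ) ^ |b| := by
  have hx : 0 < x := by linarith
  have hlog : |Real.log x| ≤ Real.log 2 := by
    rw [abs_le]
    constructor
    · rw [← Real.log_inv]
      exact Real.log_le_log (by norm_num) (by linarith)
    · exact Real.log_le_log hx h2
  have key : |Real.log x * b| ≤ Real.log 2 * |b| := by
    rw [abs_mul]
    exact mul_le_mul_of_nonneg_right hlog (abs_nonneg b)
  rw [abs_le] at key
  rw [Real.rpow_def_of_pos hx, Real.rpow_def_of_pos two_pos, ← Real.exp_neg]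
  exact ⟨Real.exp_le_exp.2 key.1, Real.exp_le_exp.2 key.2⟩

lemma one_sub_rpow_bounds {a r : ℝ} (ha : 0 < a) (hr : 0 ≤ r) (hr1 : r ≤ 1) :
    min 1 a * (1 - r) ≤ 1 - r ^ a ∧ 1 - r ^ a ≤ (1 + a) * (1 - r) := by
  rcases le_total 1 a with h | h
  · have h1 := one_add_mul_self_le_rpow_one_add (s := r - 1) (by linarith) h
    have h2 := Real.rpow_le_rpow_of_exponent_ge' hr hr1 zero_le_one h
    rw [Real.rpow_one] at h2
    rw [add_sub_cancel] at h1
    rw [min_eq_left h]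
    constructor <;> nlinarith
  · have h1 := rpow_one_add_le_one_add_mul_self (s := r - 1) (by linarith) ha.le h
    have h2 := Real.rpow_le_rpow_of_exponent_ge' hr hr1 ha.le h
    rw [Real.rpow_one] at h2
    rw [add_sub_cancel] at h1
    rw [min_eq_right h]
    constructor <;> nlinarith

/-- Here `p` is the inner product of a unit vector and a vector of norm `r ≤ 1`. -/
lemma exists_normalized_bound {a : ℝ} (ha : 0 < a) :
    ∃ K : ℝ, 1 ≤ K ∧ ∀ r p : ℝ, 0 < r → r ≤ 1 → |p| ≤ r →
      1 - 2 * r ^ (a - 1) * p + (r ^ (a - 1)) ^ 2 * r ^ 2 ≤ K * (1 - 2 * p + r ^ 2) ∧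
      1 - 2 * p + r ^ 2 ≤ K * (1 - 2 * r ^ (a - 1) * p + (r ^ (a - 1)) ^ 2 * r ^ 2) := by
  set l := min 1 a with hl
  have hl0 : 0 < l := lt_min one_pos ha
  have hl2 : 0 < (l ^ 2)⁻¹ := by positivity
  have hD : 1 ≤ (2 : ℝ) ^ |a - 1| := Real.one_le_rpow one_le_two (abs_nonneg _)
  set D := (2 : ℝ) ^ |a - 1| with hDdef
  refine ⟨20 + (1 + a) ^ 2 + D + 20 * (l ^ 2)⁻¹, by nlinarith [sq_nonneg (1 + a)], ?_⟩
  intro r p hr hr1 hp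
  obtain ⟨hp1, hp2⟩ := abs_le.1 hp
  obtain ⟨hb1, hb2⟩ := one_sub_rpow_bounds ha hr.le hr1
  have hra : r ^ a = r ^ (a - 1) * r := by
    rw [← Real.rpow_add_one hr.ne', sub_add_cancel]
  have hra1 : r ^ a ≤ 1 := Real.rpow_le_one hr.le hr1 ha.le
  have hu : 0 < r ^ (a - 1) := Real.rpow_pos_of_pos hr _
  have hwin := fun h : 1 / 2 ≤ r => rpow_bounds_of_mem_Icc (a - 1) h (by linarith)
  rw [← hDdef] at hwin
  rw [← hl] at hb1
  rw [hra] at hb1 hb2 hra1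
  set u := r ^ (a - 1)
  obtain ⟨q, rfl⟩ : ∃ q, p = r - q := ⟨r - p, by ring⟩
  have hq0 : 0 ≤ q := by linarith
  have hq2 : q ≤ 2 * r := by linarith
  have e1 : 1 - 2 * u * (r - q) + u ^ 2 * r ^ 2 = (1 - u * r) ^ 2 + 2 * (u * q) := by ring
  have e2 : 1 - 2 * (r - q) + r ^ 2 = (1 - r) ^ 2 + 2 * q := by ring
  rw [e1, e2]
  have huq : 0 ≤ u * q := by positivity
  have hur : 0 < u * r := by positivity
  have sq1 : (1 - u * r) ^ 2 ≤ (1 + a) ^ 2 * (1 - r) ^ 2 := by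
    rw [← mul_pow]; exact pow_le_pow_left₀ (by linarith) hb2 2
  have sq2 : (1 - r) ^ 2 ≤ (l ^ 2)⁻¹ * (1 - u * r) ^ 2 := by
    rw [inv_mul_eq_div, le_div_iff₀ (by positivity), mul_comm, ← mul_pow]
    exact pow_le_pow_left₀ (mul_nonneg hl0.le (by linarith)) hb1 2
  have hX : 0 ≤ (1 - u * r) ^ 2 + 2 * (u * q) := by positivity
  have hY : 0 ≤ (1 - r) ^ 2 + 2 * q := by positivity
  have mono : ∀ {k Z W : ℝ}, 0 ≤ Z → k ≤ 20 + (1 + a) ^ 2 + D + 20 * (l ^ 2)⁻¹ →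
      W ≤ k * Z → W ≤ (20 + (1 + a) ^ 2 + D + 20 * (l ^ 2)⁻¹) * Z :=
    fun hZ hk hW => hW.trans (mul_le_mul_of_nonneg_right hk hZ)
  have ha2 : 0 ≤ (1 + a) ^ 2 := sq_nonneg _
  rcases le_total r (1 / 2) with h | h
  · have hr4 : 1 / 4 ≤ (1 - r) ^ 2 := by nlinarith
    constructor
    · refine mono (k := 20) hY (by linarith) ?_
      have h3 : u * q ≤ u * (2 * r) := mul_le_mul_of_nonneg_left hq2 hu.le
      have h4 : (1 - u * r) ^ 2 ≤ 1 := pow_le_one₀ (by linarith) (by linarith)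
      linarith
    · refine mono (k := 20 * (l ^ 2)⁻¹) hX (by linarith) ?_
      have h3 : (1 - r) ^ 2 ≤ 1 := pow_le_one₀ (by linarith) (by linarith)
      have h4 : 0 ≤ (l ^ 2)⁻¹ * (u * q) := by positivity
      linarith
  · obtain ⟨hu1, hu2⟩ := hwin h
    constructor
    · refine mono (k := (1 + a) ^ 2 + D) hY (by linarith) ?_
      have h3 : u * q ≤ D * q := mul_le_mul_of_nonneg_right hu2 hq0
      have h4 : 0 ≤ (1 + a) ^ 2 * q := by positivity
      have h5 : 0 ≤ D * (1 - r) ^ 2 := by positivity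
      linarith
    · refine mono (k := (l ^ 2)⁻¹ + D) hX (by linarith) ?_
      have h3 : q ≤ D * (u * q) := by
        have : 1 ≤ D * u := by
          have := mul_le_mul_of_nonneg_left hu1 (by linarith : 0 ≤ D)
          rwa [mul_inv_cancel₀ (by linarith)] at this
        nlinarith
      have h4 : 0 ≤ (l ^ 2)⁻¹ * (u * q) := by positivity
      have h5 : 0 ≤ D * (1 - u * r) ^ 2 := by positivity
      linarith

lemma exists_ordered_bound {a : ℝ} (ha : 0 < a) :
    ∃ K : ℝ, 1 ≤ K ∧ ∀ s t p : ℝ, 0 < s → 0 < t → t ≤ s → |p| ≤ s * t →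
      (s ^ (a - 1)) ^ 2 * s ^ 2 - 2 * s ^ (a - 1) * t ^ (a - 1) * p +
          (t ^ (a - 1)) ^ 2 * t ^ 2 ≤
        K * (((s + t) ^ (a - 1)) ^ 2 * (s ^ 2 - 2 * p + t ^ 2)) ∧
      ((s + t) ^ (a - 1)) ^ 2 * (s ^ 2 - 2 * p + t ^ 2) ≤
        K * ((s ^ (a - 1)) ^ 2 * s ^ 2 - 2 * s ^ (a - 1) * t ^ (a - 1) * p +
          (t ^ (a - 1)) ^ 2 * t ^ 2) := by
  obtain ⟨K, hK, hbound⟩ := exists_normalized_bound ha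
  have hD : 1 ≤ (2 : ℝ) ^ |a - 1| := Real.one_le_rpow one_le_two (abs_nonneg _)
  refine ⟨((2 : ℝ) ^ |a - 1|) ^ 2 * K, one_le_mul_of_one_le_of_one_le (one_le_pow₀ hD) hK, ?_⟩
  intro s t p hs ht hts hp
  obtain ⟨r, rfl⟩ : ∃ r, t = s * r := ⟨t / s, by field_simp⟩
  obtain ⟨p, rfl⟩ : ∃ p', p = s ^ 2 * p' := ⟨p / s ^ 2, by field_simp⟩
  have hr : 0 < r := pos_of_mul_pos_right ht hs.le
  have hr1 : r ≤ 1 := by nlinarith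
  have hp' : |p| ≤ r := by
    rw [abs_mul, abs_of_pos (by positivity : 0 < s ^ 2)] at hp
    have : 0 < s ^ 2 := by positivity
    nlinarith
  obtain ⟨h1, h2⟩ := hbound r p hr hr1 hp'
  have e : s + s * r = s * (1 + r) := by ring
  obtain ⟨hv1, hv2⟩ := rpow_bounds_of_mem_Icc (x := 1 + r) (a - 1) (by linarith) (by linarith)
  rw [e, Real.mul_rpow hs.le hr.le, Real.mul_rpow hs.le (by linarith)]
  set D := (2 : ℝ) ^ |a - 1|
  set w := s ^ (a - 1)
  set u := r ^ (a - 1)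
  set v := (1 + r) ^ (a - 1)
  have hD0 : 0 < D := by linarith
  have hY : 0 ≤ 1 - 2 * p + r ^ 2 := by
    nlinarith [(abs_le.1 hp').2, sq_nonneg (1 - r)]
  set X := 1 - 2 * u * p + u ^ 2 * r ^ 2 with hXdef
  set Y := 1 - 2 * p + r ^ 2 with hYdef
  have hv0 : 0 < v := lt_of_lt_of_le (by positivity) hv1
  have hDv : 1 ≤ D ^ 2 * v ^ 2 := by
    rw [← mul_pow]
    refine one_le_pow₀ ?_
    have := mul_le_mul_of_nonneg_left hv1 hD0.le
    rwa [mul_inv_cancel₀ hD0.ne'] at this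
  have hvD : v ^ 2 ≤ D ^ 2 := pow_le_pow_left₀ hv0.le hv2 2
  have eX : w ^ 2 * s ^ 2 - 2 * w * (w * u) * (s ^ 2 * p) + (w * u) ^ 2 * (s * r) ^ 2 =
      (w ^ 2 * s ^ 2) * X := by rw [hXdef]; ring
  have eY : (w * v) ^ 2 * (s ^ 2 - 2 * (s ^ 2 * p) + (s * r) ^ 2) =
      (w ^ 2 * s ^ 2) * (v ^ 2 * Y) := by rw [hYdef]; ring
  rw [eX, eY, mul_left_comm (D ^ 2 * K), mul_left_comm (D ^ 2 * K) (w ^ 2 * s ^ 2) X]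
  have hws : 0 ≤ w ^ 2 * s ^ 2 := by positivity
  constructor
  · refine mul_le_mul_of_nonneg_left ?_ hws
    calc X ≤ 1 * (K * Y) := by linarith
      _ ≤ D ^ 2 * v ^ 2 * (K * Y) := mul_le_mul_of_nonneg_right hDv (by positivity)
      _ = D ^ 2 * K * (v ^ 2 * Y) := by ring
  · refine mul_le_mul_of_nonneg_left ?_ hws
    calc v ^ 2 * Y ≤ D ^ 2 * Y := mul_le_mul_of_nonneg_right hvD hY
      _ ≤ D ^ 2 * (K * X) := mul_le_mul_of_nonneg_left h2 (by positivity)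
      _ = D ^ 2 * K * X := by ring

lemma exists_scalar_bound {a : ℝ} (ha : 0 < a) :
    ∃ K : ℝ, 1 ≤ K ∧ ∀ s t p : ℝ, 0 < s → 0 < t → |p| ≤ s * t →
      (s ^ (a - 1)) ^ 2 * s ^ 2 - 2 * s ^ (a - 1) * t ^ (a - 1) * p +
          (t ^ (a - 1)) ^ 2 * t ^ 2 ≤
        K * (((s + t) ^ (a - 1)) ^ 2 * (s ^ 2 - 2 * p + t ^ 2)) ∧
      ((s + t) ^ (a - 1)) ^ 2 * (s ^ 2 - 2 * p + t ^ 2) ≤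
        K * ((s ^ (a - 1)) ^ 2 * s ^ 2 - 2 * s ^ (a - 1) * t ^ (a - 1) * p +
          (t ^ (a - 1)) ^ 2 * t ^ 2) := by
  obtain ⟨K, hK, hbound⟩ := exists_ordered_bound ha
  refine ⟨K, hK, fun s t p hs ht hp => ?_⟩
  rcases le_total t s with h | h
  · exact hbound s t p hs ht h hp
  · obtain ⟨h1, h2⟩ := hbound t s p ht hs h (by rwa [mul_comm])
    rw [add_comm t s] at h1 h2
    constructor <;> linarith

section Elliptic

variable {n N : ℕ} {C0 C1 : ℝ} {γ : Matrix (Fin n) (Fin n) ℝ}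

lemma eNorm_sq (ξ : Fin N → Fin n → ℝ) : eNorm ξ ^ 2 = ∑ i, ∑ α, ξ i α ^ 2 :=
  Real.sq_sqrt (by positivity)

lemma IsElliptic.mul_eNorm_sq_le (hγ : IsElliptic C0 C1 γ) (ξ : Fin N → Fin n → ℝ) :
    C0 * eNorm ξ ^ 2 ≤ gInner γ ξ ξ := by
  rw [eNorm_sq, Finset.mul_sum]
  exact Finset.sum_le_sum fun i _ => (hγ.2 (ξ i)).1

lemma IsElliptic.le_mul_eNorm_sq (hγ : IsElliptic C0 C1 γ) (ξ : Fin N → Fin n → ℝ) :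
    gInner γ ξ ξ ≤ C1 * eNorm ξ ^ 2 := by
  rw [eNorm_sq, Finset.mul_sum]
  exact Finset.sum_le_sum fun i _ => (hγ.2 (ξ i)).2

lemma eNorm_pos {ξ : Fin N → Fin n → ℝ} (hξ : ξ ≠ 0) : 0 < eNorm ξ := by
  obtain ⟨i, hi⟩ := Function.ne_iff.1 hξ
  obtain ⟨α, hα⟩ := Function.ne_iff.1 hi
  refine Real.sqrt_pos.2 ?_
  refine Finset.sum_pos' (fun i _ => by positivity) ⟨i, Finset.mem_univ i, ?_⟩
  exact Finset.sum_pos' (fun α _ => by positivity)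
    ⟨α, Finset.mem_univ α, sq_pos_of_ne_zero hα⟩

lemma gInner_comm (hγ : ∀ α β, γ α β = γ β α) (ξ η : Fin N → Fin n → ℝ) :
    gInner γ ξ η = gInner γ η ξ := by
  unfold gInner
  refine Finset.sum_congr rfl fun i _ => ?_
  rw [Finset.sum_comm]
  refine Finset.sum_congr rfl fun α _ => Finset.sum_congr rfl fun β _ => ?_
  rw [hγ]; ring

lemma gInner_sub_self (hγ : ∀ α β, γ α β = γ β α) (η ξ : Fin N → Fin n → ℝ) (u v : ℝ) :
    gInner γ (fun i α => u * η i α - v * ξ i α) (fun i α => u * η i α - v * ξ i α) =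
      u ^ 2 * gInner γ η η - 2 * u * v * gInner γ η ξ + v ^ 2 * gInner γ ξ ξ := by
  have h : gInner γ (fun i α => u * η i α - v * ξ i α) (fun i α => u * η i α - v * ξ i α) =
      u ^ 2 * gInner γ η η - u * v * gInner γ η ξ - u * v * gInner γ ξ η +
        v ^ 2 * gInner γ ξ ξ := by
    simp only [gInner, Finset.mul_sum, ← Finset.sum_sub_distrib, ← Finset.sum_add_distrib]
    refine Finset.sum_congr rfl fun i _ => Finset.sum_congr rfl fun α _ =>
      Finset.sum_congr rfl fun β _ => ?_
    ring
  rw [h, gInner_comm hγ ξ η]; ring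

lemma IsElliptic.gInner_self_nonneg (hC0 : 0 < C0) (hγ : IsElliptic C0 C1 γ)
    (ξ : Fin N → Fin n → ℝ) : 0 ≤ gInner γ ξ ξ :=
  le_trans (by positivity) (hγ.mul_eNorm_sq_le ξ)

lemma IsElliptic.gNorm_sq (hC0 : 0 < C0) (hγ : IsElliptic C0 C1 γ)
    (ξ : Fin N → Fin n → ℝ) : gNorm γ ξ ^ 2 = gInner γ ξ ξ :=
  Real.sq_sqrt (hγ.gInner_self_nonneg hC0 ξ)

lemma IsElliptic.gNorm_pos (hC0 : 0 < C0) (hγ : IsElliptic C0 C1 γ)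
    {ξ : Fin N → Fin n → ℝ} (hξ : ξ ≠ 0) : 0 < gNorm γ ξ := by
  have := eNorm_pos hξ
  exact Real.sqrt_pos.2 (lt_of_lt_of_le (by positivity) (hγ.mul_eNorm_sq_le ξ))

lemma IsElliptic.abs_gInner_le (hC0 : 0 < C0) (hγ : IsElliptic C0 C1 γ)
    {η ξ : Fin N → Fin n → ℝ} (hη : η ≠ 0) (hξ : ξ ≠ 0) :
    |gInner γ η ξ| ≤ gNorm γ η * gNorm γ ξ := by
  have h1 := hγ.gInner_self_nonneg hC0
    (fun i α => gNorm γ ξ * η i α - gNorm γ η * ξ i α)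
  have h2 := hγ.gInner_self_nonneg hC0
    (fun i α => gNorm γ ξ * η i α - (-gNorm γ η) * ξ i α)
  rw [gInner_sub_self hγ.1, ← hγ.gNorm_sq hC0 η, ← hγ.gNorm_sq hC0 ξ] at h1 h2
  have hst := mul_pos (hγ.gNorm_pos hC0 hη) (hγ.gNorm_pos hC0 hξ)
  rw [abs_le]
  constructor
  · refine le_of_mul_le_mul_left (a := gNorm γ η * gNorm γ ξ) ?_ hst
    linarith
  · refine le_of_mul_le_mul_left (a := gNorm γ η * gNorm γ ξ) ?_ hst
    linarith

/-- A comparison of `γ`-norms up to a factor `√K` yields one of Euclidean norms. -/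
lemma IsElliptic.mul_eNorm_le (hC0 : 0 < C0) (hγ : IsElliptic C0 C1 γ) {K x y : ℝ}
    (hK : 0 ≤ K) (hy : 0 ≤ y) {V W : Fin N → Fin n → ℝ}
    (h : x ^ 2 * gInner γ V V ≤ K * (y ^ 2 * gInner γ W W)) :
    x * eNorm V ≤ √(K * C1 / C0) * (y * eNorm W) := by
  have hW : 0 ≤ eNorm W := Real.sqrt_nonneg _
  have hV := mul_le_mul_of_nonneg_left (hγ.mul_eNorm_sq_le V) (sq_nonneg x)
  have hW' := mul_le_mul_of_nonneg_left (hγ.le_mul_eNorm_sq W) (mul_nonneg hK (sq_nonneg y))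
  have hsq : (x * eNorm V) ^ 2 ≤ K * C1 / C0 * (y * eNorm W) ^ 2 := by
    rw [div_mul_eq_mul_div, le_div_iff₀ hC0]
    linarith
  refine (Real.le_sqrt_of_sq_le hsq).trans ?_
  rw [Real.sqrt_mul' _ (sq_nonneg _), Real.sqrt_sq (mul_nonneg hy hW)]

end Elliptic

/-- Lemma 2.4 (Lemma `lem2`). -/
theorem statement1 (C0 C1 : ℝ) (hC0 : 0 < C0) (hC01 : C0 ≤ C1) (a : ℝ) (ha : 0 < a) :
    ∃ c : ℝ, 1 ≤ c ∧
      ∀ (n N : ℕ), 1 ≤ n → 1 ≤ N →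
        ∀ γ : Matrix (Fin n) (Fin n) ℝ, IsElliptic C0 C1 γ →
          ∀ η ξ : Fin N → Fin n → ℝ, η ≠ 0 → ξ ≠ 0 →
            (1 / c) *
                eNorm (fun i α => gNorm γ η ^ (a - 1) * η i α - gNorm γ ξ ^ (a - 1) * ξ i α) ≤
              (gNorm γ η + gNorm γ ξ) ^ (a - 1) * eNorm (fun i α => η i α - ξ i α) ∧
            (gNorm γ η + gNorm γ ξ) ^ (a - 1) * eNorm (fun i α => η i α - ξ i α) ≤
              c * eNorm (fun i α => gNorm γ η ^ (a - 1) * η i α - gNorm γ ξ ^ (a - 1) * ξ i α) := by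
  obtain ⟨K, hK, hbound⟩ := exists_scalar_bound ha
  have hc : 1 ≤ √(K * C1 / C0) := by
    rw [Real.one_le_sqrt, le_div_iff₀ hC0]
    nlinarith
  refine ⟨√(K * C1 / C0), hc, ?_⟩
  intro n N _ _ γ hγ η ξ hη hξ
  have hs := hγ.gNorm_pos hC0 hη
  have ht := hγ.gNorm_pos hC0 hξ
  obtain ⟨h1, h2⟩ := hbound _ _ _ hs ht (hγ.abs_gInner_le hC0 hη hξ)
  have eV := gInner_sub_self hγ.1 η ξ (gNorm γ η ^ (a - 1)) (gNorm γ ξ ^ (a - 1))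
  have eW := gInner_sub_self hγ.1 η ξ 1 1
  simp only [one_mul, one_pow, mul_one] at eW
  rw [hγ.gNorm_sq hC0 η, hγ.gNorm_sq hC0 ξ] at h1 h2
  rw [← eV, ← eW] at h1 h2
  have hP : 0 ≤ (gNorm γ η + gNorm γ ξ) ^ (a - 1) := by positivity
  have hK0 : 0 ≤ K := by linarith
  constructor
  · rw [one_div, inv_mul_le_iff₀ (by linarith)]
    simpa only [one_mul] using
      hγ.mul_eNorm_le hC0 (x := 1) hK0 hP (by simpa only [one_pow, one_mul] using h1)
  · simpa only [one_mul] using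
      hγ.mul_eNorm_le hC0 (y := 1) hK0 zero_le_one (by simpa only [one_pow, one_mul] using h2)
end
end

section
/- There exists a constant c > 0, depending only on p, such that for every a > 1 and every b ≥ 0 one has |h(b) − h(a)| · b ≤ c · ([a − 1 + (b − 1)_+]^{p−1} / (a − 1)) · |b − a|. -/
noncomputable section

open Real

/-- A Bernoulli-type bound for real powers on the unit interval. -/
lemma one_sub_rpow_le {q s : ℝ} (hq : 0 < q) (h0 : 0 ≤ s) (h1 : s ≤ 1) :
    1 - s ^ q ≤ (1 + q) * (1 - s) := by
  rcases le_total 1 q with h | h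
  · have := one_add_mul_self_le_rpow_one_add (s := s - 1) (by linarith) h
    rw [add_sub_cancel] at this
    nlinarith
  · have := rpow_le_rpow_of_exponent_ge' h0 h1 hq.le h
    rw [rpow_one] at this
    nlinarith

/-- Homogeneous form of `one_sub_rpow_le`. -/
lemma mul_rpow_sub_rpow_le {q u v : ℝ} (hq : 0 < q) (hu : 0 < u) (hv : 0 ≤ v) (hvu : v ≤ u) :
    u * (u ^ q - v ^ q) ≤ (1 + q) * u ^ q * (u - v) := by
  have h := one_sub_rpow_le hq (div_nonneg hv hu.le) ((div_le_one hu).2 hvu)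
  rw [div_rpow hv hu.le] at h
  have hk : 0 < u ^ q := rpow_pos_of_pos hu q
  calc u * (u ^ q - v ^ q) = u * u ^ q * (1 - v ^ q / u ^ q) := by field_simp
    _ ≤ u * u ^ q * ((1 + q) * (1 - v / u)) := by gcongr
    _ = (1 + q) * u ^ q * (u - v) := by field_simp

/-- Difference estimate for the power function with respect to one of its two arguments. -/
lemma mul_abs_rpow_sub_rpow_le {q x y : ℝ} (hq : 0 < q) (hx : 0 < x) (hy : 0 ≤ y) :
    x * |y ^ q - x ^ q| ≤ (1 + q) * (x + y) ^ q * |y - x| := by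
  rcases le_total y x with h | h
  · rw [abs_sub_comm, abs_sub_comm y,
      abs_of_nonneg (sub_nonneg.2 (rpow_le_rpow hy h hq.le)), abs_of_nonneg (sub_nonneg.2 h)]
    refine (mul_rpow_sub_rpow_le hq hx hy h).trans ?_
    gcongr
    · linarith
  · have hd := sub_nonneg.2 (rpow_le_rpow hx.le h hq.le)
    rw [abs_of_nonneg hd, abs_of_nonneg (sub_nonneg.2 h)]
    refine (mul_le_mul_of_nonneg_right h hd).trans
      ((mul_rpow_sub_rpow_le hq (hx.trans_le h) hx.le h).trans ?_)
    gcongr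
    · linarith

/-- Lemma `lem4`. -/
theorem statement4 (p : ℝ) (hp : 1 < p) :
    ∃ c : ℝ, 0 < c ∧
      ∀ a b : ℝ, 1 < a → 0 ≤ b →
        |hfun p b - hfun p a| * b ≤
          c * ((a - 1 + max (b - 1) 0) ^ (p - 1) / (a - 1)) * |b - a| := by
  refine ⟨p + 1, by linarith, fun a b ha hb => ?_⟩
  have hq : 0 < p - 1 := by linarith
  have hx : 0 < a - 1 := by linarith
  have hy : 0 ≤ max (b - 1) 0 := le_max_right _ _
  have hbb : hfun p b * b = (max (b - 1) 0) ^ (p - 1) := by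
    unfold hfun
    rcases hb.eq_or_lt with rfl | h
    · simp [zero_rpow hq.ne']
    · field_simp
  have hya : |max (b - 1) 0 - (a - 1)| ≤ |b - a| := by
    have h := abs_max_sub_max_le_abs (b - 1) (a - 1) 0
    rwa [max_eq_left hx.le, sub_sub_sub_cancel_right] at h
  have hha : hfun p a = (a - 1) ^ (p - 1) / a := by rw [hfun, max_eq_left hx.le]
  set x := a - 1 with hxdef
  set y := max (b - 1) 0
  have ha0 : 0 < a := by linarith
  have hsplit : (hfun p b - hfun p a) * b =
      (y ^ (p - 1) - x ^ (p - 1)) + x ^ (p - 1) * (a - b) / a := by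
    rw [sub_mul, hbb, hha]
    field_simp
    ring
  have hfirst : |y ^ (p - 1) - x ^ (p - 1)| ≤ p * ((x + y) ^ (p - 1) / x) * |b - a| := by
    rw [mul_div_assoc', div_mul_eq_mul_div, le_div_iff₀ hx, mul_comm]
    refine (mul_abs_rpow_sub_rpow_le hq hx hy).trans ?_
    rw [add_sub_cancel]
    gcongr
  have hsecond : |x ^ (p - 1) * (a - b) / a| ≤ (x + y) ^ (p - 1) / x * |b - a| := by
    rw [abs_div, abs_mul, abs_of_pos ha0, abs_of_nonneg (rpow_nonneg hx.le _), abs_sub_comm a,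
      mul_div_right_comm]
    gcongr
    · linarith
    · linarith
  calc |hfun p b - hfun p a| * b = |(hfun p b - hfun p a) * b| := by
        rw [abs_mul, abs_of_nonneg hb]
    _ ≤ |y ^ (p - 1) - x ^ (p - 1)| + |x ^ (p - 1) * (a - b) / a| := by
        rw [hsplit]
        exact abs_add_le _ _
    _ ≤ (p + 1) * ((x + y) ^ (p - 1) / x) * |b - a| := by linarith
end
end

section
/- There exists a constant c > 0, depending only on p, such that for all a, b > 1 one has |h'(b)·b − h'(a)·a| ≤ c [(a − 1)^{p−3} + (b − 1)^{p−3}] |b − a|, where h' denotes the derivative of h, which on (1,∞) is given by h'(t) = (t − 1)^{p−2}((p − 2)t + 1)/t². -/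
noncomputable section

open Real

/-- On an interval of positive reals, a power is bounded by the sum of its endpoint values. -/
lemma rpow_le_add_rpow_of_mem_uIcc {x y z : ℝ} (q : ℝ) (hx : 0 < x) (hy : 0 < y)
    (hz : z ∈ Set.uIcc x y) : z ^ q ≤ x ^ q + y ^ q := by
  wlog hxy : x ≤ y generalizing x y
  · rw [add_comm]
    exact this hy hx (Set.uIcc_comm x y ▸ hz) (le_of_not_ge hxy)
  rw [Set.uIcc_of_le hxy] at hz
  have hxq := Real.rpow_nonneg hx.le q
  have hyq := Real.rpow_nonneg hy.le q
  rcases le_total 0 q with hq | hq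
  · have := Real.rpow_le_rpow (hx.le.trans hz.1) hz.2 hq
    linarith
  · have := Real.rpow_le_rpow_of_nonpos hx hz.1 hq
    linarith

lemma hderiv_mul_self {p t : ℝ} (ht : 1 < t) :
    hderiv p t * t = (t - 1) ^ (p - 2) * (p - 2 + t⁻¹) := by
  have : t ≠ 0 := by positivity
  rw [hderiv, if_pos ht]
  field_simp

lemma hasDerivAt_rpow_mul_add_inv {p t : ℝ} (ht : 1 < t) :
    HasDerivAt (fun t : ℝ => (t - 1) ^ (p - 2) * (p - 2 + t⁻¹))
      ((t - 1) ^ (p - 3) * ((p - 2) * (p - 2 + t⁻¹) - (t - 1) / t ^ 2)) t := by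
  have hpos : 0 < t - 1 := sub_pos.2 ht
  have ht0 : t ≠ 0 := by positivity
  have h1 := ((hasDerivAt_id t).sub_const 1).rpow_const (p := p - 2) (Or.inl hpos.ne')
  have h2 := (hasDerivAt_inv ht0).const_add (p - 2)
  refine (h1.mul h2).congr_deriv ?_
  have e : (t - 1) ^ (p - 2) = (t - 1) ^ (p - 3) * (t - 1) := by
    rw [← Real.rpow_add_one hpos.ne']
    ring_nf
  have e' : p - 2 - 1 = p - 3 := by ring
  simp only [id, e, e']
  ring

lemma abs_mul_add_inv_sub_le {q t : ℝ} (ht : 1 < t) :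
    |q * (q + t⁻¹) - (t - 1) / t ^ 2| ≤ |q| * (|q| + 1) + 1 := by
  have ht0 : 0 < t := one_pos.trans ht
  have hinv : |t⁻¹| ≤ 1 := by
    rw [abs_of_pos (inv_pos.2 ht0)]
    exact inv_le_one_of_one_le₀ ht.le
  have hfrac : |(t - 1) / t ^ 2| ≤ 1 := by
    rw [abs_of_nonneg (div_nonneg (by linarith) (sq_nonneg t)), div_le_one (by positivity)]
    nlinarith
  calc |q * (q + t⁻¹) - (t - 1) / t ^ 2|
      ≤ |q * (q + t⁻¹)| + |(t - 1) / t ^ 2| := abs_sub _ _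
    _ ≤ |q| * (|q| + 1) + 1 := by
      rw [abs_mul]
      gcongr
      exact (abs_add_le _ _).trans (by gcongr)

/-- second part of Lemma `lem5`. -/
theorem statement6 (p : ℝ) (hp : 1 < p) :
    ∃ c : ℝ, 0 < c ∧
      ∀ a b : ℝ, 1 < a → 1 < b →
        |hderiv p b * b - hderiv p a * a| ≤
          c * ((a - 1) ^ (p - 3) + (b - 1) ^ (p - 3)) * |b - a| := by
  refine ⟨|p - 2| * (|p - 2| + 1) + 1, by positivity, fun a b ha hb => ?_⟩
  rw [hderiv_mul_self ha, hderiv_mul_self hb]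
  refine (convex_uIcc a b).norm_image_sub_le_of_norm_hasDerivWithin_le
    (f := fun t : ℝ => (t - 1) ^ (p - 2) * (p - 2 + t⁻¹))
    (f' := fun t => (t - 1) ^ (p - 3) * ((p - 2) * (p - 2 + t⁻¹) - (t - 1) / t ^ 2))
    (fun t ht => ?_) (fun t ht => ?_)
    Set.left_mem_uIcc Set.right_mem_uIcc
  · exact (hasDerivAt_rpow_mul_add_inv ((lt_min ha hb).trans_le ht.1)).hasDerivWithinAt
  · have ht1 : 1 < t := (lt_min ha hb).trans_le ht.1
    have hmem : t - 1 ∈ Set.uIcc (a - 1) (b - 1) := by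
      rw [← Set.image_sub_const_uIcc]
      exact Set.mem_image_of_mem _ ht
    have hpow := rpow_le_add_rpow_of_mem_uIcc (p - 3) (sub_pos.2 ha) (sub_pos.2 hb) hmem
    have hnn := Real.rpow_nonneg (sub_pos.2 ht1).le (p - 3)
    rw [Real.norm_eq_abs, abs_mul, abs_of_nonneg hnn, mul_comm]
    exact mul_le_mul (abs_mul_add_inv_sub_le ht1) hpow hnn (by positivity)
end
end

section
/- For every t > 1 one has g(t)² + g'(t)² t² ≤ (p²/(p − 1)) [h(t) + h'(t)·t] (t − 1)^p, where g' and h' denote the derivatives of g and h, which on (1,∞) are given by g'(t) = (t − 1)^{p−1}((p − 1)t + 1)/t² and h'(t) = (t − 1)^{p−2}((p − 2)t + 1)/t². -/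
noncomputable section

open Real

/-- second part of Lemma `lem6`. -/
theorem statement8 (p : ℝ) (hp : 1 < p) (t : ℝ) (ht : 1 < t) :
    gfun p t ^ 2 + gderiv p t ^ 2 * t ^ 2 ≤
      p ^ 2 / (p - 1) * (hfun p t + hderiv p t * t) * (t - 1) ^ p := by
  have hs : 0 < t - 1 := sub_pos.2 ht
  have ht0 : 0 < t := one_pos.trans ht
  have hp1 : p - 1 ≠ 0 := (sub_pos.2 hp).ne'
  have h1 : (t - 1) ^ (p - 1) = (t - 1) ^ (p - 2) * (t - 1) := by
    rw [← Real.rpow_add_one hs.ne']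
    ring_nf
  have h2 : (t - 1) ^ p = (t - 1) ^ (p - 2) * (t - 1) ^ 2 := by
    rw [← Real.rpow_add_natCast hs.ne']
    norm_num
  simp only [gfun, gderiv, hfun, hderiv, if_pos ht, max_eq_left hs.le, h1, h2]
  generalize (t - 1) ^ (p - 2) = x
  have key : 0 ≤ 2 * (x * (t - 1) / t) ^ 2 * ((t - 1) * ((p - 1) * t + 1)) := by
    have := sub_pos.2 hp
    positivity
  rw [← sub_nonneg]
  convert key using 1
  field_simp
  ring
end
end

section
/- Let ε ∈ [0,1], let γ be a (C0,C1)-elliptic symmetric matrix and let ξ ∈ ℝ^{nN} be nonzero. Then for every third-order tensor η = (η^i_{αν}) ∈ ℝ^{n²N} one has (ε + λ(|ξ|_γ)) |η|²_γ ≤ 𝒜_ε(γ,ξ)(η,η) ≤ (ε + Λ(|ξ|_γ)) |η|²_γ. -/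
noncomputable section

open Real

open scoped MatrixOrder in
theorem IsElliptic.exists_factorization {n : ℕ} {C0 C1 : ℝ} {γ : Matrix (Fin n) (Fin n) ℝ}
    (hC0 : 0 ≤ C0) (hγ : IsElliptic C0 C1 γ) :
    ∃ B : Matrix (Fin n) (Fin n) ℝ, ∀ α β, γ α β = ∑ c, B c α * B c β := by
  have hpos : γ.PosSemidef := by
    refine Matrix.posSemidef_iff_dotProduct_mulVec.2 ⟨?_, fun x => ?_⟩
    · ext α β
      simpa using hγ.1 β α
    · have h1 := (hγ.2 x).1
      have h2 : 0 ≤ C0 * ∑ α, x α ^ 2 := by positivity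
      refine (h2.trans h1).trans_eq ?_
      simp only [dotProduct, Matrix.mulVec, star_trivial, Finset.mul_sum]
      refine Finset.sum_congr rfl fun α _ => Finset.sum_congr rfl fun β _ => ?_
      ring
  obtain ⟨B, hB⟩ := CStarAlgebra.nonneg_iff_eq_star_mul_self.1 hpos.nonneg
  refine ⟨B, fun α β => ?_⟩
  rw [hB]
  simp [Matrix.mul_apply, Matrix.star_eq_conjTranspose]

section Factorization

variable {n N : ℕ} {γ B : Matrix (Fin n) (Fin n) ℝ}

theorem sum_sum_mul_eq_sum_mul_of_factorization (hB : ∀ α β, γ α β = ∑ c, B c α * B c β)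
    (f g : Fin n → ℝ) :
    ∑ α, ∑ β, γ α β * f α * g β = ∑ c, (∑ α, B c α * f α) * ∑ β, B c β * g β := by
  have h : ∀ c, (∑ α, B c α * f α) * ∑ β, B c β * g β =
      ∑ α, ∑ β, B c α * f α * (B c β * g β) := fun c => Finset.sum_mul_sum ..
  simp_rw [h]
  conv_rhs => rw [Finset.sum_comm]
  refine Finset.sum_congr rfl fun α _ => ?_
  conv_rhs => rw [Finset.sum_comm]
  refine Finset.sum_congr rfl fun β _ => ?_
  rw [hB, Finset.sum_mul, Finset.sum_mul]
  refine Finset.sum_congr rfl fun c _ => ?_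
  ring

theorem gInner_eq_sum (hB : ∀ α β, γ α β = ∑ c, B c α * B c β) (ξ η : Fin N → Fin n → ℝ) :
    gInner γ ξ η = ∑ i, ∑ c, (∑ α, B c α * ξ i α) * ∑ β, B c β * η i β :=
  Finset.sum_congr rfl fun i _ => sum_sum_mul_eq_sum_mul_of_factorization hB (ξ i) (η i)

theorem gInner_self_nonneg (hB : ∀ α β, γ α β = ∑ c, B c α * B c β) (ξ : Fin N → Fin n → ℝ) :
    0 ≤ gInner γ ξ ξ := by
  rw [gInner_eq_sum hB]
  exact Finset.sum_nonneg fun i _ => Finset.sum_nonneg fun c _ => mul_self_nonneg _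

theorem gInner_sq_le (hB : ∀ α β, γ α β = ∑ c, B c α * B c β) (ξ η : Fin N → Fin n → ℝ) :
    gInner γ ξ η ^ 2 ≤ gInner γ ξ ξ * gInner γ η η := by
  simp only [gInner_eq_sum hB, ← Fintype.sum_prod_type', ← pow_two]
  exact Finset.sum_mul_sq_le_sq_mul_sq _ _ _

theorem tNormSq_eq_sum_gInner (hB : ∀ α β, γ α β = ∑ c, B c α * B c β)
    (η : Fin N → Fin n → Fin n → ℝ) :
    tNormSq γ η = ∑ c, gInner γ (fun i α => ∑ ν, B c ν * η i α ν)
      (fun i α => ∑ ν, B c ν * η i α ν) := by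
  simp only [gInner]
  conv_rhs => rw [Finset.sum_comm]
  refine Finset.sum_congr rfl fun i _ => ?_
  conv_rhs => rw [Finset.sum_comm]
  refine Finset.sum_congr rfl fun α _ => ?_
  conv_rhs => rw [Finset.sum_comm]
  refine Finset.sum_congr rfl fun β _ => ?_
  simp_rw [mul_assoc (γ α β), ← Finset.mul_sum]
  rw [← sum_sum_mul_eq_sum_mul_of_factorization hB]

theorem Aform_eq_sum_Bform (hB : ∀ α β, γ α β = ∑ c, B c α * B c β) (p ε : ℝ)
    (ξ : Fin N → Fin n → ℝ) (η : Fin N → Fin n → Fin n → ℝ) :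
    Aform p ε γ ξ η η = ∑ c, Bform p ε γ ξ (fun i α => ∑ ν, B c ν * η i α ν)
      (fun i α => ∑ ν, B c ν * η i α ν) := by
  simp only [Bform]
  conv_rhs => rw [Finset.sum_comm]
  refine Finset.sum_congr rfl fun i _ => ?_
  conv_rhs => rw [Finset.sum_comm]
  refine Finset.sum_congr rfl fun j _ => ?_
  conv_rhs => rw [Finset.sum_comm]
  refine Finset.sum_congr rfl fun α _ => ?_
  conv_rhs => rw [Finset.sum_comm]
  refine Finset.sum_congr rfl fun β _ => ?_
  simp only [mul_assoc _ (∑ ν, B _ ν * η i α ν), ← Finset.mul_sum]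
  rw [← sum_sum_mul_eq_sum_mul_of_factorization hB]
  simp_rw [Finset.mul_sum]
  refine Finset.sum_congr rfl fun ν _ => Finset.sum_congr rfl fun σ _ => ?_
  simp only [mul_assoc]

end Factorization

theorem gInner_eq_sum_mul {n N : ℕ} {γ : Matrix (Fin n) (Fin n) ℝ}
    (hγ : ∀ α β, γ α β = γ β α) (ξ ζ : Fin N → Fin n → ℝ) :
    gInner γ ξ ζ = ∑ i, ∑ α, (∑ d, γ α d * ξ i d) * ζ i α := by
  refine Finset.sum_congr rfl fun i _ => ?_
  rw [Finset.sum_comm]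
  refine Finset.sum_congr rfl fun α _ => ?_
  rw [Finset.sum_mul]
  refine Finset.sum_congr rfl fun d _ => ?_
  rw [hγ]

theorem Bform_self_eq {n N : ℕ} {γ : Matrix (Fin n) (Fin n) ℝ}
    (hγ : ∀ α β, γ α β = γ β α) (p ε : ℝ) (ξ ζ : Fin N → Fin n → ℝ) :
    Bform p ε γ ξ ζ ζ = (hfun p (gNorm γ ξ) + ε) * gInner γ ζ ζ +
      hderiv p (gNorm γ ξ) / gNorm γ ξ * gInner γ ξ ζ ^ 2 := by
  unfold Bform
  generalize hfun p (gNorm γ ξ) + ε = a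
  simp only [add_mul, Finset.sum_add_distrib]
  congr 1
  · rw [gInner, Finset.mul_sum]
    refine Finset.sum_congr rfl fun i _ => ?_
    rw [Finset.sum_eq_single i (fun j _ hj => by simp [hj.symm]) (by simp)]
    simp only [Finset.mul_sum]
    refine Finset.sum_congr rfl fun α _ => Finset.sum_congr rfl fun β _ => ?_
    simp only [if_true]
    ring
  · rw [gInner_eq_sum_mul hγ, pow_two, Finset.sum_mul_sum, Finset.mul_sum]
    refine Finset.sum_congr rfl fun i _ => ?_
    rw [Finset.mul_sum]
    refine Finset.sum_congr rfl fun j _ => ?_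
    rw [Finset.sum_mul_sum, Finset.mul_sum]
    refine Finset.sum_congr rfl fun α _ => ?_
    conv_rhs => rw [Finset.mul_sum]
    exact Finset.sum_congr rfl fun β _ => by ring

theorem hfun_add_mul_hderiv {p t : ℝ} (ht : 1 < t) :
    hfun p t + t * hderiv p t = (p - 1) * (t - 1) ^ (p - 2) := by
  have ht0 : t ≠ 0 := by linarith
  have ht1 : 0 < t - 1 := by linarith
  have hpow : (t - 1) ^ (p - 1) = (t - 1) ^ (p - 2) * (t - 1) := by
    rw [← Real.rpow_add_one ht1.ne']
    ring_nf
  rw [hfun, hderiv, if_pos ht, max_eq_left ht1.le, hpow]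
  field_simp
  ring

theorem Bform_self_bounds {n N : ℕ} {p ε : ℝ} {γ B : Matrix (Fin n) (Fin n) ℝ} (hp : 1 < p)
    (hγ : ∀ α β, γ α β = γ β α) (hB : ∀ α β, γ α β = ∑ c, B c α * B c β)
    (ξ ζ : Fin N → Fin n → ℝ) :
    (ε + lamFun p (gNorm γ ξ)) * gInner γ ζ ζ ≤ Bform p ε γ ξ ζ ζ ∧
      Bform p ε γ ξ ζ ζ ≤ (ε + LamFun p (gNorm γ ξ)) * gInner γ ζ ζ := by
  have hsq : gNorm γ ξ ^ 2 = gInner γ ξ ξ := Real.sq_sqrt (gInner_self_nonneg hB ξ)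
  have hcs := gInner_sq_le hB ξ ζ
  rw [Bform_self_eq hγ]
  rw [← hsq] at hcs
  generalize gNorm γ ξ = t at *
  generalize gInner γ ζ ζ = T at *
  generalize gInner γ ξ ζ = v at *
  rcases le_or_gt t 1 with ht | ht
  · have hh : hfun p t = 0 := by
      rw [hfun, max_eq_right (by linarith), Real.zero_rpow (by linarith), zero_div]
    simp [hh, lamFun, LamFun, hderiv, not_lt.2 ht]
  · have ht0 : 0 < t := by linarith
    have hk := hfun_add_mul_hderiv (p := p) ht
    rw [lamFun, LamFun, if_pos ht, if_pos ht, ← hk]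
    generalize hfun p t = a
    generalize hderiv p t = d
    obtain ⟨q, rfl⟩ : ∃ q, v = t * q := ⟨v / t, by field_simp⟩
    have hq : q ^ 2 ≤ T := by
      rw [mul_pow] at hcs
      exact le_of_mul_le_mul_left hcs (by positivity)
    have hd : d / t * (t * q) ^ 2 = t * d * q ^ 2 := by field_simp
    rw [hd]
    have hq0 := sq_nonneg q
    generalize t * d = e
    generalize q ^ 2 = w at *
    have hm1 := min_le_left a (a + e)
    have hm2 := min_le_right a (a + e)
    have hM1 := le_max_left a (a + e)
    have hM2 := le_max_right a (a + e)
    constructor <;> nlinarith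

/-- Lemma `ellipticity` for the bilinear form `𝒜_ε`. -/
theorem statement9 (n N : ℕ) (hn : 1 ≤ n) (hN : 1 ≤ N) (p C0 C1 : ℝ)
    (hp : 1 < p) (hC0 : 0 < C0) (hC01 : C0 ≤ C1)
    (ε : ℝ) (hε0 : 0 ≤ ε) (hε1 : ε ≤ 1)
    (γ : Matrix (Fin n) (Fin n) ℝ) (hγ : IsElliptic C0 C1 γ)
    (ξ : Fin N → Fin n → ℝ) (hξ : ξ ≠ 0)
    (η : Fin N → Fin n → Fin n → ℝ) :
    (ε + lamFun p (gNorm γ ξ)) * tNormSq γ η ≤ Aform p ε γ ξ η η ∧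
      Aform p ε γ ξ η η ≤ (ε + LamFun p (gNorm γ ξ)) * tNormSq γ η := by
  obtain ⟨B, hB⟩ := hγ.exists_factorization hC0.le
  rw [tNormSq_eq_sum_gInner hB, Aform_eq_sum_Bform hB, Finset.mul_sum, Finset.mul_sum]
  exact ⟨Finset.sum_le_sum fun c _ => (Bform_self_bounds hp hγ.1 hB ξ _).1,
    Finset.sum_le_sum fun c _ => (Bform_self_bounds hp hγ.1 hB ξ _).2⟩
end
end

section
/- There exists a constant c > 0, depending only on p, C0 and C1, such that for every ε ∈ [0,1], every (C0,C1)-elliptic symmetric matrix γ and all ξ, ξ̃ ∈ ℝ^{nN} with |ξ|_γ > 1 one has |A_ε(γ,ξ̃) − A_ε(γ,ξ)|_γ ≤ c [ε + (|ξ|_γ − 1 + (|ξ̃|_γ − 1)_+)^{p−1} / (|ξ|_γ − 1)] |ξ − ξ̃|. -/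
noncomputable section

open Real

/-- The `γ`-inner product as a bilinear form. -/
def gBilin {n N : ℕ} (γ : Matrix (Fin n) (Fin n) ℝ) :
    LinearMap.BilinForm ℝ (Fin N → Fin n → ℝ) :=
  LinearMap.mk₂ ℝ (gInner γ)
    (fun _ _ _ => by simp [gInner, ← Finset.sum_add_distrib, mul_add, add_mul])
    (fun _ _ _ => by
      simp only [gInner, Pi.smul_apply, smul_eq_mul, Finset.mul_sum]
      refine Finset.sum_congr rfl fun i _ => Finset.sum_congr rfl fun α _ =>
        Finset.sum_congr rfl fun β _ => ?_
      ring)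
    (fun _ _ _ => by simp [gInner, ← Finset.sum_add_distrib, mul_add])
    (fun _ _ _ => by
      simp only [gInner, Pi.smul_apply, smul_eq_mul, Finset.mul_sum]
      refine Finset.sum_congr rfl fun i _ => Finset.sum_congr rfl fun α _ =>
        Finset.sum_congr rfl fun β _ => ?_
      ring)

lemma gBilin_apply {n N : ℕ} (γ : Matrix (Fin n) (Fin n) ℝ) (ξ η : Fin N → Fin n → ℝ) :
    gBilin γ ξ η = gInner γ ξ η := rfl

lemma gNorm_nonneg {n N : ℕ} (γ : Matrix (Fin n) (Fin n) ℝ) (ξ : Fin N → Fin n → ℝ) :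
    0 ≤ gNorm γ ξ := Real.sqrt_nonneg _

lemma gNorm_smul {n N : ℕ} (γ : Matrix (Fin n) (Fin n) ℝ) (r : ℝ) (ξ : Fin N → Fin n → ℝ) :
    gNorm γ (r • ξ) = |r| * gNorm γ ξ := by
  have h : gInner γ (r • ξ) (r • ξ) = r ^ 2 * gInner γ ξ ξ := by
    simp only [← gBilin_apply, map_smul, LinearMap.smul_apply, smul_eq_mul]
    ring
  rw [gNorm, h, Real.sqrt_mul (sq_nonneg r), Real.sqrt_sq_eq_abs, gNorm]

namespace IsElliptic

variable {n N : ℕ} {C0 C1 : ℝ} {γ : Matrix (Fin n) (Fin n) ℝ}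

lemma gInner_comm (hγ : IsElliptic C0 C1 γ) (ξ η : Fin N → Fin n → ℝ) :
    gInner γ ξ η = gInner γ η ξ := by
  refine Finset.sum_congr rfl fun i _ => ?_
  rw [Finset.sum_comm]
  refine Finset.sum_congr rfl fun α _ => Finset.sum_congr rfl fun β _ => ?_
  rw [hγ.1 β α]
  ring

lemma gInner_self_nonneg_s11 (hγ : IsElliptic C0 C1 γ) (hC0 : 0 ≤ C0) (ξ : Fin N → Fin n → ℝ) :
    0 ≤ gInner γ ξ ξ :=
  Finset.sum_nonneg fun i _ =>
    (mul_nonneg hC0 (Finset.sum_nonneg fun α _ => sq_nonneg (ξ i α))).trans (hγ.2 (ξ i)).1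

lemma gNorm_sq_s11 (hγ : IsElliptic C0 C1 γ) (hC0 : 0 ≤ C0) (ξ : Fin N → Fin n → ℝ) :
    gNorm γ ξ ^ 2 = gInner γ ξ ξ :=
  Real.sq_sqrt (hγ.gInner_self_nonneg_s11 hC0 ξ)

lemma gInner_le (hγ : IsElliptic C0 C1 γ) (hC0 : 0 ≤ C0) (ξ η : Fin N → Fin n → ℝ) :
    gInner γ ξ η ≤ gNorm γ ξ * gNorm γ η := by
  have h := LinearMap.BilinForm.apply_mul_apply_le_of_forall_zero_le (gBilin γ)
    (hγ.gInner_self_nonneg_s11 hC0) ξ η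
  simp only [gBilin_apply, hγ.gInner_comm η ξ, ← hγ.gNorm_sq_s11 hC0] at h
  exact le_of_sq_le_sq (by linarith) (mul_nonneg (gNorm_nonneg γ ξ) (gNorm_nonneg γ η))

lemma gNorm_add_le (hγ : IsElliptic C0 C1 γ) (hC0 : 0 ≤ C0) (ξ η : Fin N → Fin n → ℝ) :
    gNorm γ (ξ + η) ≤ gNorm γ ξ + gNorm γ η := by
  have h : gInner γ (ξ + η) (ξ + η) =
      gInner γ ξ ξ + 2 * gInner γ ξ η + gInner γ η η := by
    simp only [← gBilin_apply, map_add, LinearMap.add_apply]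
    simp only [gBilin_apply, hγ.gInner_comm η ξ]
    ring
  refine Real.sqrt_le_iff.2 ⟨add_nonneg (gNorm_nonneg γ ξ) (gNorm_nonneg γ η), ?_⟩
  rw [h, ← hγ.gNorm_sq_s11 hC0, ← hγ.gNorm_sq_s11 hC0]
  linarith [hγ.gInner_le hC0 ξ η]

lemma abs_gNorm_sub_le (hγ : IsElliptic C0 C1 γ) (hC0 : 0 ≤ C0) (ξ η : Fin N → Fin n → ℝ) :
    |gNorm γ ξ - gNorm γ η| ≤ gNorm γ (ξ - η) := by
  have h₁ := hγ.gNorm_add_le hC0 (ξ - η) η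
  have h₂ := hγ.gNorm_add_le hC0 ((-1 : ℝ) • (ξ - η)) ξ
  rw [gNorm_smul, show (-1 : ℝ) • (ξ - η) + ξ = η by module] at h₂
  rw [sub_add_cancel] at h₁
  norm_num at h₂
  exact abs_le.2 ⟨by linarith, by linarith⟩

lemma gNorm_le_eNorm (hγ : IsElliptic C0 C1 γ) (hC1 : 0 ≤ C1) (ξ : Fin N → Fin n → ℝ) :
    gNorm γ ξ ≤ √C1 * eNorm ξ := by
  rw [gNorm, eNorm, ← Real.sqrt_mul hC1, Finset.mul_sum]
  exact Real.sqrt_le_sqrt (Finset.sum_le_sum fun i _ => (hγ.2 (ξ i)).2)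

end IsElliptic

lemma eNorm_sub_comm {n N : ℕ} (ξ η : Fin N → Fin n → ℝ) :
    eNorm (fun i α => ξ i α - η i α) = eNorm (fun i α => η i α - ξ i α) := by
  simp only [eNorm, sub_sq_comm]

/-- The power function `t ↦ t ^ q` is Lipschitz with a constant controlled by `(x + y) ^ q / x`. -/
lemma abs_rpow_sub_rpow_le {q x y : ℝ} (hq : 0 < q) (hx : 0 < x) (hy : 0 ≤ y) :
    |y ^ q - x ^ q| ≤ (2 + 2 * q) * ((x + y) ^ q / x) * |y - x| := by
  have hK : 0 ≤ (x + y) ^ q / x := by positivity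
  rcases le_total y (x / 2) with h | h
  · have h₁ : |y ^ q - x ^ q| ≤ (x + y) ^ q := by
      have hxq : x ^ q ≤ (x + y) ^ q := by gcongr; linarith
      have hyq : y ^ q ≤ (x + y) ^ q := by gcongr; linarith
      have := Real.rpow_nonneg hx.le q
      have := Real.rpow_nonneg hy q
      exact abs_le.2 ⟨by linarith, by linarith⟩
    have h₂ : x ≤ 2 * |y - x| := by linarith [neg_le_abs (y - x)]
    calc |y ^ q - x ^ q| ≤ (x + y) ^ q / x * x := by rwa [div_mul_cancel₀ _ hx.ne']
      _ ≤ (x + y) ^ q / x * (2 * |y - x|) := by gcongr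
      _ ≤ _ := by nlinarith [mul_nonneg (mul_nonneg hq.le hK) (abs_nonneg (y - x))]
  · have h₁ : ∀ t ∈ Set.Icc (x / 2) (x + y), ‖q * t ^ (q - 1)‖ ≤ 2 * q * ((x + y) ^ q / x) := by
      rintro t ⟨ht₁, ht₂⟩
      have ht : 0 < t := by linarith
      rw [Real.norm_of_nonneg (by positivity), Real.rpow_sub_one ht.ne']
      calc q * (t ^ q / t) ≤ q * ((x + y) ^ q / (x / 2)) := by gcongr
        _ = _ := by field_simp
    have h₂ := (convex_Icc (x / 2) (x + y)).norm_image_sub_le_of_norm_hasDerivWithin_le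
      (f := fun t => t ^ q) (x := x) (y := y)
      (fun t ht => (Real.hasDerivAt_rpow_const
        (Or.inl (by linarith [ht.1] : (0 : ℝ) < t).ne')).hasDerivWithinAt)
      h₁ ⟨by linarith, by linarith⟩ ⟨h, by linarith⟩
    simp only [Real.norm_eq_abs] at h₂
    nlinarith [mul_nonneg hK (abs_nonneg (y - x))]

/-- The Lipschitz-type estimate for the vector field `A_ε`, measured in the `γ`-norm. -/
lemma IsElliptic.gNorm_Avf_sub_le {n N : ℕ} {C0 C1 p ε : ℝ} {γ : Matrix (Fin n) (Fin n) ℝ}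
    (hγ : IsElliptic C0 C1 γ) (hC0 : 0 ≤ C0) (hp : 1 < p) (hε : 0 ≤ ε)
    {ξ ξ' : Fin N → Fin n → ℝ} (hξ : 1 < gNorm γ ξ) :
    gNorm γ (Avf p ε γ ξ' - Avf p ε γ ξ) ≤
      (2 + 2 * p) * (ε + (gNorm γ ξ - 1 + max (gNorm γ ξ' - 1) 0) ^ (p - 1) /
        (gNorm γ ξ - 1)) * gNorm γ (ξ' - ξ) := by
  have hd := hγ.abs_gNorm_sub_le hC0 ξ' ξ
  have hb := gNorm_nonneg γ ξ'
  have hb' : hfun p (gNorm γ ξ') * gNorm γ ξ' = max (gNorm γ ξ' - 1) 0 ^ (p - 1) := by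
    rcases hb.eq_or_lt with h | h
    · rw [← h, mul_zero, max_eq_right (by norm_num), Real.zero_rpow (by linarith)]
    · exact div_mul_cancel₀ _ h.ne'
  have ha' : hfun p (gNorm γ ξ) = (gNorm γ ξ - 1) ^ (p - 1) / gNorm γ ξ := by
    rw [hfun, max_eq_left (by linarith)]
  set a := gNorm γ ξ
  set b := gNorm γ ξ'
  set d := gNorm γ (ξ' - ξ)
  set x := a - 1 with hx
  set y := max (b - 1) 0
  have ha : 0 < a := by linarith
  have hx0 : 0 < x := by linarith
  have hy0 : 0 ≤ y := le_max_right _ _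
  have hd0 : 0 ≤ d := (abs_nonneg _).trans hd
  have hyx : |y - x| ≤ d := by
    refine le_trans ?_ hd
    have h := abs_max_sub_max_le_abs (b - 1) x 0
    rwa [max_eq_left hx0.le, show b - 1 - x = b - a by rw [hx]; ring] at h
  have hpow := abs_rpow_sub_rpow_le (sub_pos.2 hp) hx0 hy0
  have hyp : y ^ (p - 1) / a ≤ (x + y) ^ (p - 1) / x := by
    gcongr <;> linarith
  have hK : 0 ≤ (x + y) ^ (p - 1) / x := by positivity
  have key : Avf p ε γ ξ' - Avf p ε γ ξ =
      (ε + y ^ (p - 1) / a) • (ξ' - ξ) +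
        ((hfun p b * ((a - b) / a)) • ξ' + ((y ^ (p - 1) - x ^ (p - 1)) / a) • ξ) := by
    ext i α
    simp only [Avf, Pi.sub_apply, Pi.add_apply, Pi.smul_apply, smul_eq_mul]
    change (hfun p b + ε) * ξ' i α - (hfun p a + ε) * ξ i α = _
    rw [ha', ← hb']
    field_simp
    ring
  have h₁ : gNorm γ ((ε + y ^ (p - 1) / a) • (ξ' - ξ)) ≤ (ε + (x + y) ^ (p - 1) / x) * d := by
    rw [gNorm_smul, abs_of_nonneg (by positivity)]
    gcongr
  have h₂ : gNorm γ ((hfun p b * ((a - b) / a)) • ξ') ≤ (x + y) ^ (p - 1) / x * d := by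
    have hh : 0 ≤ hfun p b := div_nonneg (Real.rpow_nonneg hy0 _) hb
    rw [gNorm_smul, abs_mul, abs_div, abs_of_nonneg hh, abs_of_pos ha, abs_sub_comm]
    calc hfun p b * (|b - a| / a) * b = hfun p b * b / a * |b - a| := by ring
      _ ≤ _ := by rw [hb']; gcongr
  have h₃ : gNorm γ (((y ^ (p - 1) - x ^ (p - 1)) / a) • ξ) ≤
      (2 + 2 * (p - 1)) * ((x + y) ^ (p - 1) / x) * d := by
    rw [gNorm_smul, abs_div, abs_of_pos ha, div_mul_cancel₀ _ ha.ne']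
    refine hpow.trans ?_
    have : 0 ≤ 2 + 2 * (p - 1) := by linarith
    gcongr
  rw [key]
  have h₄ := hγ.gNorm_add_le hC0 ((ε + y ^ (p - 1) / a) • (ξ' - ξ))
    ((hfun p b * ((a - b) / a)) • ξ' + ((y ^ (p - 1) - x ^ (p - 1)) / a) • ξ)
  have h₅ := hγ.gNorm_add_le hC0 ((hfun p b * ((a - b) / a)) • ξ')
    (((y ^ (p - 1) - x ^ (p - 1)) / a) • ξ)
  have h₆ : 0 ≤ (1 + 2 * p) * (ε * d) := by positivity
  linarith

/-- part 1) of Lemma `monotonicity`. -/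
theorem statement11 (p C0 C1 : ℝ) (hp : 1 < p) (hC0 : 0 < C0) (hC01 : C0 ≤ C1) :
    ∃ c : ℝ, 0 < c ∧
      ∀ (n N : ℕ), 1 ≤ n → 1 ≤ N →
        ∀ ε : ℝ, 0 ≤ ε → ε ≤ 1 →
          ∀ γ : Matrix (Fin n) (Fin n) ℝ, IsElliptic C0 C1 γ →
            ∀ ξ ξ' : Fin N → Fin n → ℝ, 1 < gNorm γ ξ →
              gNorm γ (fun i α => Avf p ε γ ξ' i α - Avf p ε γ ξ i α) ≤
                c * (ε + (gNorm γ ξ - 1 + max (gNorm γ ξ' - 1) 0) ^ (p - 1) /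
                      (gNorm γ ξ - 1)) *
                  eNorm (fun i α => ξ i α - ξ' i α) := by
  have hC1 : 0 < C1 := hC0.trans_le hC01
  refine ⟨(2 + 2 * p) * √C1, by positivity, ?_⟩
  intro n N _ _ ε hε _ γ hγ ξ ξ' hξ
  refine (hγ.gNorm_Avf_sub_le hC0.le hp hε hξ).trans ?_
  have hle := hγ.gNorm_le_eNorm hC1.le (ξ' - ξ)
  have hK : 0 ≤ ε + (gNorm γ ξ - 1 + max (gNorm γ ξ' - 1) 0) ^ (p - 1) / (gNorm γ ξ - 1) :=
    have hx : 0 < gNorm γ ξ - 1 := sub_pos.2 hξ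
    by positivity
  rw [eNorm_sub_comm, mul_right_comm _ (√C1), mul_assoc _ (√C1)]
  gcongr
  exact hle
end
end
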